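/- Let v ∈ ℝⁿ, n ≥ 2, satisfy S_c⁺(v) ≤ 2. Then for any w ∈ ℝⁿ with S_c⁻(Δ_c w) ≤ 2, it holds that S_c⁻(Δ_c H_{sign(v)} w) ≤ 2. -/

import Mathlib

open scoped BigOperators

/-- Number of sign changes in a list of reals after deleting zero entries;
`-1` if all entries are zero. -/
noncomputable def signChangesList (l : List ℝ) : ℤ :=
  let nz := l.filter (fun x => decide (x ≠ 0))
  if nz.isEmpty then -1
  else ((nz.zip nz.tail).countP (fun p => decide (p.1 * p.2 < 0)) : ℤ)

/-- `S⁻(v)`: number of sign changes of `v` after deleting zeros (`-1` for `v = 0`). -/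
noncomputable def Sminus {n : ℕ} (v : Fin n → ℝ) : ℤ :=
  signChangesList (List.ofFn v)

/-- `w` is obtained from `v` by replacing (some of the) zero entries by arbitrary reals. -/
def FillsZeros {n : ℕ} (v w : Fin n → ℝ) : Prop := ∀ i, v i ≠ 0 → w i = v i

/-- `S⁺(v)`: maximum of `S⁻` over all fillings of the zero entries of `v`. -/
noncomputable def Splus {n : ℕ} (v : Fin n → ℝ) : ℤ :=
  sSup {z : ℤ | ∃ w : Fin n → ℝ, FillsZeros v w ∧ z = Sminus w}

/-- the rotated list `[v i, v (i+1), …, v (i+n-1), v i]`. -/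
noncomputable def cycList {n : ℕ} (v : Fin n → ℝ) (i : Fin n) : List ℝ :=
  (List.ofFn fun j : Fin n => v (i + j)) ++ [v i]

/-- cyclic variation `S_c⁻(v)`: the supremum of `S⁻` over all cyclic rotations
`[v_i, …, v_n, v_1, …, v_i]` of `v`. -/
noncomputable def Scminus {n : ℕ} (v : Fin n → ℝ) : ℤ :=
  sSup {z : ℤ | ∃ i : Fin n, z = signChangesList (cycList v i)}

/-- cyclic variation `S_c⁺(v)`: the supremum of `S_c⁻` over all fillings of the
zero entries of `v`. -/
noncomputable def Scplus {n : ℕ} (v : Fin n → ℝ) : ℤ :=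
  sSup {z : ℤ | ∃ w : Fin n → ℝ, FillsZeros v w ∧ z = Scminus w}

/-- cyclic successor index `i + 1 (mod n)`. -/
def cnext {n : ℕ} (i : Fin n) : Fin n :=
  ⟨(i.val + 1) % n, Nat.mod_lt _ (Nat.lt_of_le_of_lt (Nat.zero_le _) i.isLt)⟩

/-- cyclic predecessor index `i - 1 (mod n)`. -/
def cprev {n : ℕ} (i : Fin n) : Fin n :=
  ⟨(i.val + (n - 1)) % n, Nat.mod_lt _ (Nat.lt_of_le_of_lt (Nat.zero_le _) i.isLt)⟩

/-- cyclic forward difference `(Δ_c v)_i = v_{i+1 (mod n)} - v_i`. -/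
noncomputable def cdiff {n : ℕ} (v : Fin n → ℝ) : Fin n → ℝ :=
  fun i => v (cnext i) - v i

/-- number of positive entries. -/
noncomputable def Pp {n : ℕ} (v : Fin n → ℝ) : ℕ :=
  (Finset.univ.filter fun i => 0 < v i).card

/-- number of negative entries. -/
noncomputable def Pn {n : ℕ} (v : Fin n → ℝ) : ℕ :=
  (Finset.univ.filter fun i => v i < 0).card

/-- one period of the `P`-periodic summation `ḡ(t) = ∑_{k ∈ ℤ} g(t + kP)`. -/
noncomputable def pbar (g : ℤ → ℝ) (P : ℕ) : Fin P → ℝ :=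
  fun i => ∑' k : ℤ, g (((i : ℕ) : ℤ) + k * (P : ℤ))

/-- convolution `(g ∗ u)(t) = ∑_{τ ∈ ℤ} g(t - τ) u(τ)`. -/
noncomputable def conv (g u : ℤ → ℝ) : ℤ → ℝ :=
  fun t => ∑' τ : ℤ, g (t - τ) * u τ

/-- the cyclic back-shift matrix `Q_P`, mapping `e_j` to `e_{j+1 (mod P)}`. -/
def Qmat (P : ℕ) : Matrix (Fin P) (Fin P) ℝ :=
  Matrix.of fun i j => if (i : ℕ) = ((j : ℕ) + 1) % P then 1 else 0

/-- sign changes of `s :: l` (zeros of `l` skipped). -/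
noncomputable def chg : ℝ → List ℝ → ℕ
  | _, [] => 0
  | s, x :: l => if x = 0 then chg s l else (if s * x < 0 then 1 else 0) + chg x l

/-- the list splits in `k+1` blocks of alternating weak sign, starting with sign `e`. -/
def Blk : ℝ → ℕ → List ℝ → Prop
  | e, 0, l => ∀ x ∈ l, 0 ≤ e * x
  | e, k + 1, l => ∃ l1 l2, l = l1 ++ l2 ∧ (∀ x ∈ l1, 0 ≤ e * x) ∧ Blk (-e) k l2

lemma chg_eq (l : List ℝ) : ∀ a : ℝ,
    (((a :: l.filter (fun x => decide (x ≠ 0))).zip (l.filter (fun x => decide (x ≠ 0)))).countP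
      (fun p => decide (p.1 * p.2 < 0))) = chg a l := by
  induction l with
  | nil => intro a; simp [chg]
  | cons x l ih =>
    intro a
    by_cases hx : x = 0
    · simp only [chg, hx, if_true]
      rw [← ih a]
      simp
    · rw [List.filter_cons_of_pos (by simpa using hx)]
      simp only [chg, hx, if_false]
      rw [← ih x, List.zip_cons_cons, List.countP_cons]
      simp only [decide_eq_true_eq]
      omega

lemma scl_nil : signChangesList [] = -1 := by simp [signChangesList]

lemma scl_zero (l : List ℝ) : signChangesList (0 :: l) = signChangesList l := by
  simp [signChangesList]

lemma scl_cons (x : ℝ) (l : List ℝ) (hx : x ≠ 0) :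
    signChangesList (x :: l) = (chg x l : ℤ) := by
  rw [← chg_eq]
  unfold signChangesList
  rw [List.filter_cons_of_pos (by simpa using hx)]
  simp

lemma chg_le (l : List ℝ) : ∀ a : ℝ, chg a l ≤ l.length := by
  induction l with
  | nil => intro a; simp [chg]
  | cons x l ih =>
    intro a
    simp only [chg, List.length_cons]
    have := ih a
    have := ih x
    split_ifs <;> omega

lemma scl_le (l : List ℝ) : signChangesList l ≤ l.length := by
  induction l with
  | nil => simp [scl_nil]
  | cons x l ih =>
    by_cases hx : x = 0
    · subst hx; rw [scl_zero, List.length_cons]; push_cast; omega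
    · rw [scl_cons x l hx]
      have := chg_le l x
      rw [List.length_cons]; push_cast; omega

lemma Blk.cons {e : ℝ} {k : ℕ} {l : List ℝ} {x : ℝ} (hx : 0 ≤ e * x) (h : Blk e k l) :
    Blk e k (x :: l) := by
  cases k with
  | zero =>
    intro y hy
    rcases List.mem_cons.1 hy with rfl | hy
    · exact hx
    · exact h y hy
  | succ k =>
    obtain ⟨l1, l2, rfl, h1, h2⟩ := h
    refine ⟨x :: l1, l2, rfl, ?_, h2⟩
    intro y hy
    rcases List.mem_cons.1 hy with rfl | hy
    · exact hx
    · exact h1 y hy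

lemma Blk.tail (l : List ℝ) (x : ℝ) (k : ℕ) : ∀ e : ℝ, Blk e k (x :: l) → Blk e k l := by
  induction k with
  | zero =>
    intro e h y hy
    exact h y (List.mem_cons_of_mem _ hy)
  | succ k ih =>
    rintro e ⟨l1, l2, h, h1, h2⟩
    cases l1 with
    | nil =>
      simp only [List.nil_append] at h
      subst h
      exact ⟨[], l, rfl, by simp, ih _ h2⟩
    | cons z l1 =>
      simp only [List.cons_append, List.cons.injEq] at h
      obtain ⟨rfl, rfl⟩ := h
      exact ⟨l1, l2, rfl, fun y hy => h1 y (List.mem_cons_of_mem _ hy), h2⟩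

lemma Blk.neg_head {l : List ℝ} {x : ℝ} {k : ℕ} {e : ℝ} (hx : e * x < 0)
    (h : Blk e k (x :: l)) : ∃ j, k = j + 1 ∧ Blk (-e) j (x :: l) := by
  cases k with
  | zero => exact absurd (h x (by simp)) (not_le.2 hx)
  | succ k =>
    obtain ⟨l1, l2, h, h1, h2⟩ := h
    cases l1 with
    | nil =>
      simp only [List.nil_append] at h
      subst h
      exact ⟨k, rfl, h2⟩
    | cons z l1 =>
      simp only [List.cons_append, List.cons.injEq] at h
      obtain ⟨rfl, rfl⟩ := h
      exact absurd (h1 x (by simp)) (not_le.2 hx)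

lemma mul_sign {e s x : ℝ} (hs : 0 < e * s) (hx : 0 < e * x) : ¬ s * x < 0 := by
  intro h
  nlinarith [mul_pos hs hx, sq_nonneg e]

lemma mul_sign' {e s x : ℝ} (hs : 0 < e * s) (hx : e * x < 0) : s * x < 0 := by
  by_contra h
  nlinarith [mul_neg_of_pos_of_neg hs hx, mul_nonneg (sq_nonneg e) (not_lt.1 h)]

lemma blk_of_chg (l : List ℝ) : ∀ (e s : ℝ) (k : ℕ), 0 < e * s → chg s l ≤ k → Blk e k l := by
  induction l with
  | nil =>
    intro e s k _ _
    induction k generalizing e s with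
    | zero => intro y hy; simp at hy
    | succ k ih =>
      exact ⟨[], [], rfl, by simp, ih (-e) (-s) (by linarith) (by simp [chg])⟩
  | cons x l ih =>
    intro e s k hs hk
    simp only [chg] at hk
    by_cases hx : x = 0
    · rw [if_pos hx] at hk
      exact Blk.cons (by simp [hx]) (ih e s k hs hk)
    · rw [if_neg hx] at hk
      have he : e ≠ 0 := by rintro rfl; simp at hs
      rcases lt_or_gt_of_ne (mul_ne_zero he hx) with h | h
      · rw [if_pos (mul_sign' hs h)] at hk
        obtain ⟨j, rfl⟩ : ∃ j, k = j + 1 := ⟨k - 1, by omega⟩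
        refine ⟨[], x :: l, rfl, by simp, Blk.cons (by linarith) (ih (-e) x j (by linarith) (by omega))⟩
      · exact Blk.cons h.le (ih e x k h (by omega))

lemma chg_of_blk (l : List ℝ) : ∀ (e s : ℝ) (k : ℕ), 0 < e * s → Blk e k l → chg s l ≤ k := by
  induction l with
  | nil => intros; simp [chg]
  | cons x l ih =>
    intro e s k hs hb
    simp only [chg]
    by_cases hx : x = 0
    · rw [if_pos hx]
      exact ih e s k hs (Blk.tail _ _ _ _ hb)
    · rw [if_neg hx]
      have he : e ≠ 0 := by rintro rfl; simp at hs
      rcases lt_or_gt_of_ne (mul_ne_zero he hx) with h | h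
      · obtain ⟨j, rfl, hb'⟩ := Blk.neg_head h hb
        have := ih (-e) x j (by linarith) (Blk.tail _ _ _ _ hb')
        split_ifs <;> omega
      · rw [if_neg (mul_sign hs h)]
        have := ih e x k h (Blk.tail _ _ _ _ hb)
        omega

lemma scl_of_blk (l : List ℝ) (e : ℝ) (he : e ≠ 0) (k : ℕ) (hb : Blk e k l) :
    signChangesList l ≤ k := by
  induction l with
  | nil => rw [scl_nil]; omega
  | cons x l ih =>
    by_cases hx : x = 0
    · subst hx; rw [scl_zero]; exact ih (Blk.tail _ _ _ _ hb)
    · rw [scl_cons x l hx]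
      rcases lt_or_gt_of_ne (mul_ne_zero he hx) with h | h
      · obtain ⟨j, rfl, hb'⟩ := Blk.neg_head h hb
        have := chg_of_blk l (-e) x j (by linarith) (Blk.tail _ _ _ _ hb')
        push_cast; omega
      · have := chg_of_blk l e x k h (Blk.tail _ _ _ _ hb)
        omega

/-- periodic extension -/
noncomputable def lft {n : ℕ} [NeZero n] (x : Fin n → ℝ) (k : ℤ) : ℝ :=
  x ⟨(k % (n : ℤ)).toNat, by
    have h0 : (0 : ℤ) < n := by exact_mod_cast Nat.pos_of_ne_zero (NeZero.ne n)
    have := Int.emod_lt_of_pos k h0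
    have := Int.emod_nonneg k h0.ne'
    omega⟩

lemma lft_add {n : ℕ} [NeZero n] (x : Fin n → ℝ) (k : ℤ) : lft x (k + n) = lft x k := by
  simp [lft]

lemma lft_addm {n : ℕ} [NeZero n] (x : Fin n → ℝ) (k m : ℤ) : lft x (k + m * n) = lft x k := by
  simp [lft]

lemma lft_val {n : ℕ} [NeZero n] (x : Fin n → ℝ) (i : Fin n) : lft x ((i : ℕ) : ℤ) = x i := by
  unfold lft
  congr 1
  apply Fin.ext
  have : ((i : ℕ) : ℤ) % n = ((i : ℕ) : ℤ) := Int.emod_eq_of_lt (by omega) (by have := i.2; omega)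
  simp [this]

lemma lft_eq {n : ℕ} [NeZero n] (x : Fin n → ℝ) (i : Fin n) (k : ℤ) (h : (n : ℤ) ∣ k - (i : ℕ)) :
    lft x k = x i := by
  obtain ⟨m, hm⟩ := h
  rw [← lft_val x i, ← lft_addm x ((i : ℕ) : ℤ) m]
  congr 1
  linarith

lemma ex_fin {n : ℕ} [NeZero n] (k : ℤ) : ∃ i : Fin n, (n : ℤ) ∣ k - (i : ℕ) := by
  have h0 : (0 : ℤ) < n := by exact_mod_cast Nat.pos_of_ne_zero (NeZero.ne n)
  have h1 := Int.emod_lt_of_pos k h0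
  have h2 := Int.emod_nonneg k h0.ne'
  refine ⟨⟨(k % (n : ℤ)).toNat, by omega⟩, ?_⟩
  simp only [Int.toNat_of_nonneg h2]
  exact Int.dvd_self_sub_emod

lemma lft_cdiff {n : ℕ} [NeZero n] (x : Fin n → ℝ) (k : ℤ) :
    lft (cdiff x) k = lft x (k + 1) - lft x k := by
  obtain ⟨i, hi⟩ := ex_fin (n := n) k
  rw [lft_eq _ i k hi, lft_eq _ i k hi, lft_eq x (cnext i) (k + 1)]
  · rfl
  · have : (n : ℤ) ∣ ((i : ℕ) + 1 : ℤ) - (((i : ℕ) + 1 : ℤ) % n) := Int.dvd_self_sub_emod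
    have h := dvd_add hi this
    simp only [cnext]
    push_cast
    obtain ⟨c, hc⟩ := h
    exact ⟨c, by rw [← hc]; ring⟩

lemma cycList_eq {n : ℕ} [NeZero n] (x : Fin n → ℝ) (i : Fin n) :
    cycList x i = (List.range' 0 (n + 1)).map (fun j : ℕ => lft x ((i : ℕ) + (j : ℤ))) := by
  rw [← List.range_eq_range', List.range_succ, List.map_append, cycList]
  congr 1
  · apply List.ext_getElem
    · simp
    · intro j h1 h2
      simp only [List.length_ofFn] at h1
      simp only [List.getElem_ofFn, List.getElem_map, List.getElem_range]
      symm
      apply lft_eq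
      simp only [Fin.val_add]
      push_cast
      exact Int.dvd_self_sub_emod
  · simp only [List.map_cons, List.map_nil, lft_add, lft_val]

/-- arcs property -/
def PP (N : ℤ) (x : ℤ → ℝ) : Prop :=
  ∃ p q : ℤ, p ≤ q ∧ q ≤ p + N ∧ (∀ s, p ≤ s → s < q → 0 ≤ x s) ∧
    (∀ s, q ≤ s → s < p + N → x s ≤ 0)

/-- no alternation -/
def QQ (N : ℤ) (x : ℤ → ℝ) : Prop :=
  ∀ a b c d : ℤ, a < b → b < c → c < d → d < a + N →
    0 < x a → x b < 0 → 0 < x c → x d < 0 → False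

lemma per_mul {N : ℤ} {x : ℤ → ℝ} (hp : ∀ k, x (k + N) = x k) (m : ℤ) :
    ∀ k, x (k + m * N) = x k := by
  induction m using Int.induction_on with
  | zero => intro k; simp
  | succ i ih => intro k; rw [← ih k, ← hp (k + i * N)]; congr 1; ring
  | pred i ih => intro k; rw [← ih k, ← hp (k + (-i - 1) * N)]; congr 1; ring

lemma ex_shift {N : ℤ} (hN : 0 < N) (a p : ℤ) : ∃ m : ℤ, p ≤ a + m * N ∧ a + m * N < p + N := by
  refine ⟨-((a - p) / N), ?_, ?_⟩
  · have := Int.emod_nonneg (a - p) hN.ne'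
    have := Int.emod_add_mul_ediv (a - p) N
    nlinarith
  · have := Int.emod_lt_of_pos (a - p) hN
    have := Int.emod_add_mul_ediv (a - p) N
    nlinarith

lemma QQ_of_PP {N : ℤ} (hN : 0 < N) {x : ℤ → ℝ} (hp : ∀ k, x (k + N) = x k) (h : PP N x) :
    QQ N x := by
  obtain ⟨p, q, h1, h2, h3, h4⟩ := h
  have h3' : ∀ s, p + N ≤ s → s < q + N → 0 ≤ x s := by
    intro s hs1 hs2
    have := h3 (s - N) (by omega) (by omega)
    rwa [← hp, sub_add_cancel] at this
  intro a b c d hab hbc hcd hda xa xb xc xd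
  obtain ⟨m, hm1, hm2⟩ := ex_shift hN a p
  rw [← per_mul hp m] at xa xb xc xd
  generalize m * N = z at *
  have A : a + z < q := by
    by_contra hh
    exact absurd (h4 _ (by omega) hm2) (not_le.2 xa)
  have B : q ≤ b + z := by
    by_contra hh
    exact absurd (h3 _ (by omega) (by omega)) (not_le.2 xb)
  have C : p + N ≤ c + z := by
    by_contra hh
    exact absurd (h4 _ (by omega) (by omega)) (not_le.2 xc)
  exact absurd (h3' (d + z) (by omega) (by omega)) (not_le.2 xd)

lemma cross (f : ℤ → ℝ) (a b : ℤ) (hab : a ≤ b)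
    (hf : ∀ s, a ≤ s → s < b → f (s + 1) ≤ f s) :
    ∃ q, a ≤ q ∧ q ≤ b ∧ (∀ s, a ≤ s → s < q → 0 ≤ f s) ∧ (∀ s, q ≤ s → s < b → f s ≤ 0) := by
  induction b, hab using Int.leInduction with
  | base => exact ⟨a, le_rfl, le_rfl, fun s _ _ => by omega, fun s _ _ => by omega⟩
  | succ b hab ih =>
    obtain ⟨q, h1, h2, h3, h4⟩ := ih (fun s hs1 hs2 => hf s hs1 (by omega))
    by_cases hb : f b ≤ 0
    · refine ⟨q, h1, by omega, h3, fun s hs1 hs2 => ?_⟩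
      by_cases hs : s = b
      · rwa [hs]
      · exact h4 s hs1 (by omega)
    · refine ⟨b + 1, by omega, le_rfl, fun s hs1 hs2 => ?_, fun s _ _ => by omega⟩
      by_cases hs : s = b
      · rw [hs]; linarith
      · by_cases hsq : s < q
        · exact h3 s hs1 hsq
        · have hq : f (b - 1) ≤ 0 := h4 (b - 1) (by omega) (by omega)
          have := hf (b - 1) (by omega) (by omega)
          rw [sub_add_cancel] at this
          exact absurd (this.trans hq) hb

lemma mono_of_step (f : ℤ → ℝ) (a b : ℤ) (hf : ∀ s, a ≤ s → s < b → f s ≤ f (s + 1))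
    (s t : ℤ) (h1 : a ≤ s) (h2 : s ≤ t) (h3 : t ≤ b) : f s ≤ f t := by
  induction t, h2 using Int.leInduction with
  | base => exact le_rfl
  | succ t h ih => exact (ih (by omega)).trans (hf t (by omega) (by omega))

lemma PP_diff_aux {N : ℤ} (hN : 0 < N) {W : ℤ → ℝ} (hp : ∀ k, W (k + N) = W k)
    (h : PP N (fun k => W (k + 1) - W k)) (d : ℤ) (hd0 : 0 ≤ d) (hd : d < N) :
    PP N (fun s => W s - W (s - d)) := by
  obtain ⟨m, M, h1, h2, h3, h4⟩ := h
  have up : ∀ s t, m ≤ s → s ≤ t → t ≤ M → W s ≤ W t :=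
    mono_of_step W m M (fun s a b => by have := h3 s a b; linarith)
  have dn : ∀ s t, M ≤ s → s ≤ t → t ≤ m + N → W t ≤ W s := by
    intro s t a b c
    have := mono_of_step (fun s => - W s) M (m + N)
      (fun s a b => by have := h4 s a b; linarith) s t a b c
    linarith
  have hpm : ∀ k, W (k - N) = W k := fun k => by rw [← hp (k - N), sub_add_cancel]
  have up' : ∀ s t, m + N ≤ s → s ≤ t → t ≤ M + N → W s ≤ W t := by
    intro s t a b c
    have := up (s - N) (t - N) (by omega) (by omega) (by omega)
    rwa [hpm, hpm] at this
  set D : ℤ → ℝ := fun s => W s - W (s - d) with hD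
  have hDp : ∀ k, D (k + N) = D k := by
    intro k
    simp only [hD]
    rw [hp, show k + N - d = k - d + N by ring, hp]
  -- four zones
  have z1 : ∀ s, min (m + d) M ≤ s → s ≤ max (m + d) M → 0 ≤ D s := by
    intro s a b
    simp only [hD, sub_nonneg]
    rcases le_total (m + d) M with hc | hc
    · rw [min_eq_left hc] at a; rw [max_eq_right hc] at b
      exact up _ _ (by omega) (by omega) b
    · rw [min_eq_right hc] at a; rw [max_eq_left hc] at b
      rw [← hp (s - d)]
      exact dn _ _ (by omega) (by omega) (by omega)
  have z3 : ∀ s, min (M + d) (m + N) ≤ s → s ≤ max (M + d) (m + N) → D s ≤ 0 := by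
    intro s a b
    simp only [hD, sub_nonpos]
    rcases le_total (M + d) (m + N) with hc | hc
    · rw [min_eq_left hc] at a; rw [max_eq_right hc] at b
      exact dn _ _ (by omega) (by omega) b
    · rw [min_eq_right hc] at a; rw [max_eq_left hc] at b
      rw [← hpm s]
      exact up _ _ (by omega) (by omega) (by omega)
  obtain ⟨q, q1, q2, q3, q4⟩ := cross D (max (m + d) M) (min (M + d) (m + N)) (by omega) (by
    intro s a b
    have := dn s (s + 1) (by omega) (by omega) (by omega)
    have := up (s - d) (s + 1 - d) (by omega) (by omega) (by omega)
    simp only [hD]; linarith)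
  obtain ⟨r, r1, r2, r3, r4⟩ := cross (fun s => - D s) (max (M + d) (m + N)) (min (m + d) M + N)
    (by omega) (by
    intro s a b
    have := up' s (s + 1) (by omega) (by omega) (by omega)
    have := dn (s - d) (s + 1 - d) (by omega) (by omega) (by omega)
    simp only [hD]; linarith)
  refine ⟨r - N, q, by omega, by omega, ?_, ?_⟩
  · intro s a b
    by_cases c1 : s < min (m + d) M
    · have := r4 (s + N) (by omega) (by omega)
      simp only [hDp] at this; linarith
    · by_cases c2 : s ≤ max (m + d) M
      · exact z1 s (by omega) c2
      · exact q3 s (by omega) b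
  · intro s a b
    by_cases c1 : s < min (M + d) (m + N)
    · exact q4 s a c1
    · by_cases c2 : s ≤ max (M + d) (m + N)
      · exact z3 s (by omega) c2
      · have := r3 s (by omega) (by omega)
        linarith

lemma PP_diff {N : ℤ} (hN : 0 < N) {W : ℤ → ℝ} (hp : ∀ k, W (k + N) = W k)
    (h : PP N (fun k => W (k + 1) - W k)) (d : ℤ) :
    PP N (fun s => W s - W (s - d)) := by
  obtain ⟨m, h1, h2⟩ := ex_shift hN d 0
  have := PP_diff_aux hN hp h (d + m * N) h1 (by omega)
  convert this using 3 with s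
  rw [← per_mul hp (-m) (s - d)]
  congr 1; ring

/-- doubled sequence -/
noncomputable def dbl (w : ℤ → ℝ) (s : ℤ) : ℝ := w (s / 2) + w ((s + 1) / 2)

lemma dbl_per {N : ℤ} {w : ℤ → ℝ} (hp : ∀ k, w (k + N) = w k) (k : ℤ) :
    dbl w (k + 2 * N) = dbl w k := by
  unfold dbl
  rw [show (k + 2 * N) / 2 = k / 2 + N by omega,
    show (k + 2 * N + 1) / 2 = (k + 1) / 2 + N by omega, hp, hp]

lemma dbl_PP {N : ℤ} {w : ℤ → ℝ} (h : PP N (fun k => w (k + 1) - w k)) :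
    PP (2 * N) (fun k => dbl w (k + 1) - dbl w k) := by
  obtain ⟨p, q, h1, h2, h3, h4⟩ := h
  have key : ∀ k, dbl w (k + 1) - dbl w k = w (k / 2 + 1) - w (k / 2) := by
    intro k
    unfold dbl
    rw [show (k + 1 + 1) / 2 = k / 2 + 1 by omega]
    ring
  refine ⟨2 * p, 2 * q, by omega, by omega, ?_, ?_⟩
  · intro s a b
    simp only [key]
    exact h3 (s / 2) (by omega) (by omega)
  · intro s a b
    simp only [key]
    exact h4 (s / 2) (by omega) (by omega)

lemma dbl_split (w : ℤ → ℝ) (a b : ℤ) (h1 : a ≤ b) (h2 : b ≤ a + 1) :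
    dbl w (a + b) = w a + w b := by
  unfold dbl
  rw [show (a + b) / 2 = a by omega, show (a + b + 1) / 2 = b by omega]

/-- main combinatorial fact -/
lemma PP_main {N : ℤ} (hN : 0 < N) {w : ℤ → ℝ} (hp : ∀ k, w (k + N) = w k)
    (h : PP N (fun k => w (k + 1) - w k)) (a b a' b' : ℤ) (h1 : a ≤ b) (h2 : b ≤ a + 1)
    (h1' : a' ≤ b') (h2' : b' ≤ a' + 1) :
    PP N (fun t => (w (t - b) + w (t - a)) - (w (t - b') + w (t - a'))) := by
  obtain ⟨p, q, g1, g2, g3, g4⟩ := PP_diff (N := 2 * N) (by omega) (dbl_per hp) (dbl_PP h) (a' + b' - a - b)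
  have key : ∀ t, (w (t - b) + w (t - a)) - (w (t - b') + w (t - a')) =
      dbl w (2 * t - a - b) - dbl w (2 * t - a - b - (a' + b' - a - b)) := by
    intro t
    rw [← dbl_split w (t - b) (t - a) (by omega) (by omega),
      ← dbl_split w (t - b') (t - a') (by omega) (by omega)]
    congr 2 <;> ring
  refine ⟨(p + a + b + 1) / 2, (q + a + b + 1) / 2, by omega, by omega, ?_, ?_⟩
  · intro s hs1 hs2
    simp only [key]
    exact g3 _ (by omega) (by omega)
  · intro s hs1 hs2
    simp only [key]
    exact g4 _ (by omega) (by omega)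

lemma npos (n : ℕ) [NeZero n] : (0 : ℤ) < n := by
  exact_mod_cast Nat.pos_of_ne_zero (NeZero.ne n)

lemma scl_le_Scminus {n : ℕ} (x : Fin n → ℝ) (i : Fin n) :
    signChangesList (cycList x i) ≤ Scminus x := by
  refine le_csSup ?_ ⟨i, rfl⟩
  refine ⟨n + 1, ?_⟩
  rintro _ ⟨j, rfl⟩
  refine (scl_le _).trans ?_
  simp [cycList]

lemma Scminus_le {n : ℕ} [NeZero n] (x : Fin n → ℝ) (k : ℤ)
    (h : ∀ i, signChangesList (cycList x i) ≤ k) : Scminus x ≤ k := by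
  refine csSup_le ⟨_, ⟨⟨0, Nat.pos_of_ne_zero (NeZero.ne n)⟩, rfl⟩⟩ ?_
  rintro _ ⟨j, rfl⟩
  exact h j

lemma Scminus_fill {n : ℕ} [NeZero n] (v x : Fin n → ℝ) (hx : FillsZeros v x) :
    Scminus x ≤ Scplus v := by
  refine le_csSup ?_ ⟨x, hx, rfl⟩
  refine ⟨n + 1, ?_⟩
  rintro _ ⟨y, _, rfl⟩
  refine Scminus_le y _ fun i => (scl_le _).trans ?_
  simp [cycList]

lemma PP_of_Scminus {n : ℕ} [NeZero n] (x : Fin n → ℝ) (h : Scminus x ≤ 2) : PP n (lft x) := by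
  have hn := npos n
  by_cases hpos : ∃ i, 0 < x i
  swap
  · push Not at hpos
    exact ⟨0, 0, le_rfl, by omega, fun s _ _ => by omega, fun s _ _ => hpos _⟩
  obtain ⟨i, hi⟩ := hpos
  have h2 := (scl_le_Scminus x i).trans h
  have hc := cycList_eq x i
  obtain ⟨l, hl⟩ : ∃ l, cycList x i = x i :: l := by
    rw [hc, List.range'_succ, List.map_cons]
    refine ⟨(List.range' (0 + 1) n).map (fun j : ℕ => lft x ((i : ℕ) + (j : ℤ))), ?_⟩
    congr 1
    simp [lft_val]
  have hb : Blk 1 2 (cycList x i) := by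
    rw [hl] at h2 ⊢
    rw [scl_cons _ _ hi.ne'] at h2
    exact Blk.cons (by linarith) (blk_of_chg l 1 (x i) 2 (by linarith) (by exact_mod_cast h2))
  rw [hc] at hb
  obtain ⟨l1, l2', e1, b1, l2, l3, e2, b2, b3⟩ := hb
  subst e2
  rw [List.map_eq_append_iff] at e1
  obtain ⟨r1, r2', e1, rfl, e2⟩ := e1
  rw [List.map_eq_append_iff] at e2
  obtain ⟨r2, r3, rfl, rfl, rfl⟩ := e2
  rw [List.range'_eq_append_iff] at e1
  obtain ⟨k1, hk1, rfl, e1⟩ := e1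
  symm at e1
  rw [List.range'_eq_append_iff] at e1
  obtain ⟨k2, hk2, rfl, rfl⟩ := e1
  have g1 : ∀ j : ℕ, j < k1 → 0 ≤ lft x ((i : ℕ) + (j : ℤ)) := by
    intro j hj
    have := b1 (lft x ((i : ℕ) + (j : ℤ))) (List.mem_map.2 ⟨j, by simp [List.mem_range'_1]; omega, rfl⟩)
    linarith
  have g2 : ∀ j : ℕ, k1 ≤ j → j < k1 + k2 → lft x ((i : ℕ) + (j : ℤ)) ≤ 0 := by
    intro j hj hj'
    have := b2 (lft x ((i : ℕ) + (j : ℤ))) (List.mem_map.2 ⟨j, by simp [List.mem_range'_1]; omega, rfl⟩)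
    linarith
  have g3 : ∀ j : ℕ, k1 + k2 ≤ j → j < n + 1 → 0 ≤ lft x ((i : ℕ) + (j : ℤ)) := by
    intro j hj hj'
    have := b3 (lft x ((i : ℕ) + (j : ℤ))) (List.mem_map.2 ⟨j, by simp [List.mem_range'_1]; omega, rfl⟩)
    linarith
  clear b1 b2 b3
  have g1' : ∀ s : ℤ, (i : ℕ) ≤ s → s < (i : ℕ) + k1 → 0 ≤ lft x s := by
    intro s a b
    have := g1 (s - (i : ℕ)).toNat (by omega)
    rwa [show ((i : ℕ) : ℤ) + ((s - (i : ℕ)).toNat : ℤ) = s by omega] at this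
  have g2' : ∀ s : ℤ, (i : ℕ) + k1 ≤ s → s < (i : ℕ) + k1 + k2 → lft x s ≤ 0 := by
    intro s a b
    have := g2 (s - (i : ℕ)).toNat (by omega) (by omega)
    rwa [show ((i : ℕ) : ℤ) + ((s - (i : ℕ)).toNat : ℤ) = s by omega] at this
  have g3' : ∀ s : ℤ, (i : ℕ) + k1 + k2 ≤ s → s < (i : ℕ) + n + 1 → 0 ≤ lft x s := by
    intro s a b
    have := g3 (s - (i : ℕ)).toNat (by omega) (by omega)
    rwa [show ((i : ℕ) : ℤ) + ((s - (i : ℕ)).toNat : ℤ) = s by omega] at this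
  refine ⟨(i : ℕ) + min ((k1 : ℤ) + k2) n - n, (i : ℕ) + min (k1 : ℤ) n, by omega, by omega, ?_, ?_⟩
  · intro s a b
    by_cases c : s < (i : ℕ)
    · rw [← lft_add]
      by_cases c2 : (k1 : ℤ) + k2 ≤ n
      · exact g3' _ (by omega) (by omega)
      · omega
    · exact g1' s (by omega) (by omega)
  · intro s a b
    exact g2' s (by omega) (by omega)

lemma blk_of_index (g : ℕ → ℝ) (e : ℝ) (L k1 k2 k3 : ℕ) (hL : L = k1 + k2 + k3)
    (h1 : ∀ j, j < k1 → 0 ≤ e * g j) (h2 : ∀ j, k1 ≤ j → j < k1 + k2 → 0 ≤ (-e) * g j)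
    (h3 : ∀ j, k1 + k2 ≤ j → j < L → 0 ≤ e * g j) : Blk e 2 ((List.range' 0 L).map g) := by
  refine ⟨(List.range' 0 k1).map g, (List.range' k1 k2).map g ++ (List.range' (k1 + k2) k3).map g,
    ?_, ?_, (List.range' k1 k2).map g, (List.range' (k1 + k2) k3).map g, rfl, ?_, ?_⟩
  · rw [← List.map_append, ← List.map_append, List.range'_append_1]
    have := List.range'_append_1 (s := 0) (m := k1) (n := k2 + k3)
    rw [zero_add] at this
    rw [this, hL, add_assoc]
  · intro y hy
    obtain ⟨j, hj, rfl⟩ := List.mem_map.1 hy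
    rw [List.mem_range'_1] at hj
    exact h1 j (by omega)
  · intro y hy
    obtain ⟨j, hj, rfl⟩ := List.mem_map.1 hy
    rw [List.mem_range'_1] at hj
    exact h2 j (by omega) (by omega)
  · intro y hy
    obtain ⟨j, hj, rfl⟩ := List.mem_map.1 hy
    rw [List.mem_range'_1] at hj
    have := h3 j (by omega) (by omega)
    linarith

lemma Scminus_of_PP {n : ℕ} [NeZero n] (x : Fin n → ℝ) (h : PP n (lft x)) : Scminus x ≤ 2 := by
  have hn := npos n
  obtain ⟨p, q, h1, h2, h3, h4⟩ := h
  have h3' : ∀ s, p + n ≤ s → s < q + n → 0 ≤ lft x s := by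
    intro s hs1 hs2
    have := h3 (s - n) (by omega) (by omega)
    rwa [← lft_add, sub_add_cancel] at this
  have h4' : ∀ s, q + n ≤ s → s < p + n + n → lft x s ≤ 0 := by
    intro s hs1 hs2
    have := h4 (s - n) (by omega) (by omega)
    rwa [← lft_add, sub_add_cancel] at this
  refine Scminus_le x 2 fun i => ?_
  rw [cycList_eq]
  obtain ⟨m, m1, m2⟩ := ex_shift hn ((i : ℕ) : ℤ) p
  have key : ∀ j : ℕ, lft x ((i : ℕ) + (j : ℤ)) = lft x ((i : ℕ) + m * n + j) := by
    intro j
    rw [← lft_addm x _ m]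
    congr 1; ring
  simp only [key]
  generalize ((i : ℕ) : ℤ) + m * n = z at *
  by_cases hz : z < q
  · refine scl_of_blk _ 1 one_ne_zero 2 (blk_of_index _ 1 (n + 1) (q - z).toNat (p + n - q).toNat
      (z - p + 1).toNat (by omega) ?_ ?_ ?_)
    · intro j hj
      have := h3 (z + j) (by omega) (by omega)
      linarith
    · intro j hj hj'
      have := h4 (z + j) (by omega) (by omega)
      linarith
    · intro j hj hj'
      have := h3' (z + j) (by omega) (by omega)
      linarith
  · refine scl_of_blk _ (-1) (by norm_num) 2 (blk_of_index _ (-1) (n + 1) (p + n - z).toNat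
      (q - p).toNat (z - q + 1).toNat (by omega) ?_ ?_ ?_)
    · intro j hj
      have := h4 (z + j) (by omega) (by omega)
      linarith
    · intro j hj hj'
      have := h3' (z + j) (by omega) (by omega)
      linarith
    · intro j hj hj'
      have := h4' (z + j) (by omega) (by omega)
      linarith

lemma sum_per_aux {n : ℕ} (hn : (0 : ℤ) < n) (F : ℤ → ℝ) (hF : ∀ k, F (k + n) = F k) (a : ℤ) :
    ∑ k ∈ Finset.Ico a (a + n), F k = ∑ k ∈ Finset.Ico (a + 1) (a + 1 + n), F k := by
  have e1 : Finset.Ico a (a + n) = insert a (Finset.Ico (a + 1) (a + n)) := by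
    ext k; simp only [Finset.mem_insert, Finset.mem_Ico]; omega
  have e2 : Finset.Ico (a + 1) (a + 1 + n) = insert (a + n) (Finset.Ico (a + 1) (a + n)) := by
    ext k; simp only [Finset.mem_insert, Finset.mem_Ico]; omega
  rw [e1, e2, Finset.sum_insert (by simp), Finset.sum_insert (by simp), hF]

lemma sum_per {n : ℕ} (hn : (0 : ℤ) < n) (F : ℤ → ℝ) (hF : ∀ k, F (k + n) = F k) (a : ℤ) :
    ∑ k ∈ Finset.Ico a (a + n), F k = ∑ j : Fin n, F ((j : ℕ) : ℤ) := by
  have h0 : ∑ k ∈ Finset.Ico (0 : ℤ) (0 + n), F k = ∑ j : Fin n, F ((j : ℕ) : ℤ) := by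
    rw [Fin.sum_univ_eq_sum_range (fun j : ℕ => F (j : ℤ)) n]
    symm
    refine Finset.sum_bij (fun j _ => (j : ℤ)) ?_ ?_ ?_ ?_
    · intro j hj; simp at hj ⊢; omega
    · intro i _ j _ h; simpa using h
    · intro k hk
      simp only [Finset.mem_Ico] at hk
      exact ⟨k.toNat, by simp; omega, by omega⟩
    · intros; rfl
  rw [← h0]
  induction a using Int.induction_on with
  | zero => rfl
  | succ i ih => rw [← sum_per_aux hn F hF, ih]
  | pred i ih => rw [sum_per_aux hn F hF, ← ih, sub_add_cancel]

lemma lft_mulVec {n : ℕ} [NeZero n] (u w : Fin n → ℝ) (t a : ℤ) :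
    lft ((Matrix.circulant u).mulVec w) t =
      ∑ k ∈ Finset.Ico a (a + n), lft u k * lft w (t - k) := by
  have hn := npos n
  have hF : ∀ k : ℤ, lft u (k + n) * lft w (t - (k + n)) = lft u k * lft w (t - k) := by
    intro k
    rw [lft_add, ← lft_add w (t - (k + n))]
    congr 2; ring
  rw [sum_per hn (fun k => lft u k * lft w (t - k)) hF]
  obtain ⟨i, hi⟩ := ex_fin (n := n) t
  rw [lft_eq _ i t hi]
  simp only [Matrix.mulVec, dotProduct, Matrix.circulant_apply]
  refine Fintype.sum_equiv (Equiv.subLeft i) _ _ ?_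
  intro j
  simp only [Equiv.subLeft_apply]
  rw [lft_val]
  congr 1
  symm
  apply lft_eq
  have e : (n : ℤ) ∣ ((i : ℕ) : ℤ) - (j : ℕ) - ((i - j : Fin n) : ℕ) := by
    rw [Fin.val_sub]
    push_cast [j.2.le]
    have : (n : ℤ) ∣ ((n : ℤ) - (j : ℕ) + (i : ℕ)) - ((n : ℤ) - (j : ℕ) + (i : ℕ)) % n :=
      Int.dvd_self_sub_emod
    have := dvd_sub this (dvd_refl (n : ℤ))
    obtain ⟨c, hc⟩ := this
    exact ⟨c, by rw [← hc]; ring⟩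
  have := dvd_add hi e
  obtain ⟨c, hc⟩ := this
  exact ⟨c, by rw [← hc]; ring⟩

lemma tele (w : ℤ → ℝ) (t p q : ℤ) (h : p ≤ q) :
    ∑ k ∈ Finset.Ico p q, (w (t + 1 - k) - w (t - k)) = w (t + 1 - p) - w (t + 1 - q) := by
  induction q, h using Int.leInduction with
  | base => simp
  | succ q h ih =>
    have e1 : Finset.Ico p (q + 1) = insert q (Finset.Ico p q) := by
      ext k; simp only [Finset.mem_insert, Finset.mem_Ico]; omega
    rw [e1, Finset.sum_insert (by simp), ih, show t + 1 - (q + 1) = t - q by ring]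
    ring

/-- contribution of an indicator of an arc -/
lemma arc_sum {n : ℕ} [NeZero n] (f w : Fin n → ℝ) (t p q : ℤ) (h1 : p ≤ q) (h2 : q ≤ p + n)
    (hf1 : ∀ k, p ≤ k → k < q → lft f k = 1) (hf0 : ∀ k, q ≤ k → k < p + n → lft f k = 0) :
    lft (cdiff ((Matrix.circulant f).mulVec w)) t = lft w (t + 1 - p) - lft w (t + 1 - q) := by
  rw [lft_cdiff, lft_mulVec f w _ p, lft_mulVec f w _ p, ← Finset.sum_sub_distrib,
    ← tele (lft w) t p q h1]
  symm
  rw [← Finset.sum_subset (Finset.Ico_subset_Ico le_rfl h2)]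
  · apply Finset.sum_congr rfl
    intro k hk
    rw [Finset.mem_Ico] at hk
    rw [hf1 k hk.1 hk.2]; ring
  · intro k hk hk'
    rw [Finset.mem_Ico] at hk hk'
    rw [hf0 k (by omega) hk.2]; ring

lemma weak_alt {n : ℕ} [NeZero n] (v : Fin n → ℝ) (hv : Scplus v ≤ 2) (a b c d : ℤ)
    (hab : a < b) (hbc : b < c) (hcd : c < d) (hda : d < a + n)
    (xa : 0 ≤ lft v a) (xb : lft v b ≤ 0) (xc : 0 ≤ lft v c) (xd : lft v d ≤ 0) : False := by
  classical
  have hn := npos n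
  set x : Fin n → ℝ := fun i => if v i ≠ 0 then v i else
    if (n : ℤ) ∣ a - (i : ℕ) ∨ (n : ℤ) ∣ c - (i : ℕ) then 1 else -1 with hx
  have hfill : FillsZeros v x := by
    intro i hi
    simp only [hx, if_pos hi]
  have hQ := QQ_of_PP hn (lft_add x) (PP_of_Scminus x ((Scminus_fill v x hfill).trans hv))
  have pos : ∀ s, 0 ≤ lft v s → s = a ∨ s = c → 0 < lft x s := by
    intro s hs hs'
    obtain ⟨i, hi⟩ := ex_fin (n := n) s
    rw [lft_eq v i s hi] at hs
    rw [lft_eq x i s hi]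
    simp only [hx]
    by_cases h0 : v i = 0
    · rw [if_neg (by simpa using h0), if_pos (by rcases hs' with rfl | rfl <;> simp [hi])]
      norm_num
    · rw [if_pos h0]; exact lt_of_le_of_ne hs (Ne.symm h0)
  have nd : ∀ s s' : ℤ, s < s' → s' < s + n → ¬ (n : ℤ) ∣ s' - s := by
    intro s s' h1 h2 h3
    have := Int.le_of_dvd (by omega) h3
    omega
  have neg : ∀ s, lft v s ≤ 0 → s = b ∨ s = d → lft x s < 0 := by
    intro s hs hs'
    obtain ⟨i, hi⟩ := ex_fin (n := n) s
    rw [lft_eq v i s hi] at hs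
    rw [lft_eq x i s hi]
    simp only [hx]
    by_cases h0 : v i = 0
    · rw [if_neg (by simpa using h0), if_neg]
      · norm_num
      · rintro (h | h)
        · have h' := dvd_sub hi h
          rw [sub_sub_sub_cancel_right] at h'
          rcases hs' with rfl | rfl
          · exact nd _ _ (by omega) (by omega) h'
          · exact nd _ _ (by omega) (by omega) h'
        · rcases hs' with rfl | rfl
          · have h' := dvd_sub h hi
            rw [sub_sub_sub_cancel_right] at h'
            exact nd _ _ (by omega) (by omega) h'
          · have h' := dvd_sub hi h
            rw [sub_sub_sub_cancel_right] at h'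
            exact nd _ _ (by omega) (by omega) h'
    · rw [if_pos h0]; exact lt_of_le_of_ne hs h0
  exact hQ a b c d hab hbc hcd hda (pos a xa (Or.inl rfl)) (neg b xb (Or.inl rfl))
    (pos c xc (Or.inr rfl)) (neg d xd (Or.inr rfl))

/-- the set of positive entries is an arc -/
lemma pos_arc {n : ℕ} [NeZero n] (v : Fin n → ℝ) (hv : Scplus v ≤ 2) :
    ∃ p q : ℤ, p ≤ q ∧ q ≤ p + n ∧ (∀ s, p ≤ s → s < q → 0 < lft v s) ∧
      (∀ s, q ≤ s → s < p + n → lft v s ≤ 0) := by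
  set x : Fin n → ℝ := fun i => if v i ≠ 0 then v i else -1 with hx
  have hfill : FillsZeros v x := by
    intro i hi
    simp only [hx, if_pos hi]
  obtain ⟨p, q, h1, h2, h3, h4⟩ := PP_of_Scminus x ((Scminus_fill v x hfill).trans hv)
  have key : ∀ s, lft x s = if lft v s ≠ 0 then lft v s else -1 := fun s => rfl
  refine ⟨p, q, h1, h2, fun s a b => ?_, fun s a b => ?_⟩
  · have := h3 s a b
    rw [key] at this
    split_ifs at this with h
    · exact lt_of_le_of_ne this (Ne.symm h)
    · norm_num at this
  · have := h4 s a b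
    rw [key] at this
    split_ifs at this with h
    · exact this
    · simp only [ne_eq, not_not] at h
      exact h.le

/-- the set of negative entries is an arc -/
lemma neg_arc {n : ℕ} [NeZero n] (v : Fin n → ℝ) (hv : Scplus v ≤ 2) :
    ∃ r s : ℤ, r ≤ s ∧ s ≤ r + n ∧ (∀ k, r ≤ k → k < s → lft v k < 0) ∧
      (∀ k, s ≤ k → k < r + n → 0 ≤ lft v k) := by
  set x : Fin n → ℝ := fun i => if v i ≠ 0 then v i else 1 with hx
  have hfill : FillsZeros v x := by
    intro i hi
    simp only [hx, if_pos hi]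
  obtain ⟨p, q, h1, h2, h3, h4⟩ := PP_of_Scminus x ((Scminus_fill v x hfill).trans hv)
  have key : ∀ s, lft x s = if lft v s ≠ 0 then lft v s else 1 := fun s => rfl
  refine ⟨q, p + n, h2, by omega, fun s a b => ?_, fun s a b => ?_⟩
  · have := h4 s a b
    rw [key] at this
    split_ifs at this with h
    · exact lt_of_le_of_ne this h
    · norm_num at this
  · have := h3 (s - n) (by omega) (by omega)
    rw [← lft_add, sub_add_cancel, key] at this
    split_ifs at this with h
    · exact this
    · simp only [ne_eq, not_not] at h
      exact h.ge

lemma PP_half {N : ℤ} {f g : ℤ → ℝ} (h : PP N f) (hg : ∀ t, f t = 2 * g t) : PP N g := by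
  obtain ⟨p, q, h1, h2, h3, h4⟩ := h
  exact ⟨p, q, h1, h2, fun s a b => by have := h3 s a b; have := hg s; linarith,
    fun s a b => by have := h4 s a b; have := hg s; linarith⟩

/-- If `v ∈ ℝⁿ`, `n ≥ 2`, satisfies `S_c⁺(v) ≤ 2`, then for any `w` with
`S_c⁻(Δ_c w) ≤ 2` it holds that `S_c⁻(Δ_c H_{sign(v)} w) ≤ 2`. -/
theorem stmt8 {n : ℕ} (hn : 2 ≤ n) (v : Fin n → ℝ) (hv : Scplus v ≤ 2)
    (w : Fin n → ℝ) (hw : Scminus (cdiff w) ≤ 2) :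
    Scminus (cdiff ((Matrix.circulant fun i => Real.sign (v i)).mulVec w)) ≤ 2 := by
  have : NeZero n := ⟨by omega⟩
  have hN := npos n
  obtain ⟨p, q, p1, p2, p3, p4⟩ := pos_arc v hv
  obtain ⟨r₀, s₀, r1, r2, r3, r4⟩ := neg_arc v hv
  -- shift the negative arc
  obtain ⟨r, s, hrs, hsr, n3, n4, hqr, hrq⟩ : ∃ r s : ℤ, r ≤ s ∧ s ≤ r + n ∧
      (∀ k, r ≤ k → k < s → lft v k < 0) ∧ (∀ k, s ≤ k → k < r + n → 0 ≤ lft v k) ∧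
      q ≤ r ∧ r < q + n := by
    obtain ⟨m, m1, m2⟩ := ex_shift hN r₀ q
    refine ⟨r₀ + m * n, s₀ + m * n, by omega, by omega, ?_, ?_, m1, m2⟩
    · intro k a b
      have := r3 (k - m * n) (by omega) (by omega)
      rwa [← lft_addm v _ m, sub_add_cancel] at this
    · intro k a b
      have := r4 (k - m * n) (by omega) (by omega)
      rwa [← lft_addm v _ m, sub_add_cancel] at this
  set f : Fin n → ℝ := fun i => if 0 < v i then 1 else 0 with hf
  set g : Fin n → ℝ := fun i => if v i < 0 then 1 else 0 with hg
  have hfg : (fun i => Real.sign (v i)) = f - g := by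
    funext i
    simp only [hf, hg, Pi.sub_apply]
    rcases lt_trichotomy (v i) 0 with h | h | h
    · rw [Real.sign_of_neg h, if_neg (by linarith), if_pos h]; norm_num
    · simp [h]
    · rw [Real.sign_of_pos h, if_pos h, if_neg (by linarith)]; norm_num
  have keyf : ∀ k, lft f k = if 0 < lft v k then 1 else 0 := fun k => rfl
  have keyg : ∀ k, lft g k = if lft v k < 0 then 1 else 0 := fun k => rfl
  have hy : ∀ t, lft (cdiff ((Matrix.circulant fun i => Real.sign (v i)).mulVec w)) t =
      (lft w (t + 1 - p) - lft w (t + 1 - q)) - (lft w (t + 1 - r) - lft w (t + 1 - s)) := by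
    intro t
    rw [← arc_sum f w t p q p1 p2 (fun k a b => by rw [keyf, if_pos (p3 k a b)])
        (fun k a b => by rw [keyf, if_neg (not_lt.2 (p4 k a b))]),
      ← arc_sum g w t r s hrs hsr (fun k a b => by rw [keyg, if_pos (n3 k a b)])
        (fun k a b => by rw [keyg, if_neg (not_lt.2 (n4 k a b))]), hfg]
    rw [Matrix.circulant_sub, Matrix.sub_mulVec]
    simp only [lft, cdiff, Pi.sub_apply]
    ring
  apply Scminus_of_PP
  have hW : PP n (fun k => lft w (k + 1) - lft w k) := by
    have := PP_of_Scminus _ hw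
    simpa only [lft_cdiff, funext (lft_cdiff w)] using this
  by_cases hpq : p = q
  · refine PP_half (PP_main hN (lft_add w) hW (s - 1) (s - 1) (r - 1) (r - 1) le_rfl (by omega)
      le_rfl (by omega)) fun t => ?_
    rw [hy, hpq, show t + 1 - r = t - (r - 1) by ring, show t + 1 - s = t - (s - 1) by ring]
    ring
  by_cases hrs' : r = s
  · refine PP_half (PP_main hN (lft_add w) hW (p - 1) (p - 1) (q - 1) (q - 1) le_rfl (by omega)
      le_rfl (by omega)) fun t => ?_
    rw [hy, hrs', show t + 1 - p = t - (p - 1) by ring, show t + 1 - q = t - (q - 1) by ring]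
    ring
  have hrp : r < p + n := by
    by_contra hh
    have h1 := p3 (r - n) (by omega) (by omega)
    rw [← lft_add, sub_add_cancel] at h1
    have h2 := n3 r le_rfl (by omega)
    linarith
  have hsp : s ≤ p + n := by
    by_contra hh
    have h1 := p3 p le_rfl (by omega)
    have h2 := n3 (p + n) (by omega) (by omega)
    rw [lft_add] at h2
    linarith
  have n4' : ∀ k, q ≤ k → k < r → 0 ≤ lft v k := by
    intro k a b
    have := n4 (k + n) (by omega) (by omega)
    rwa [lft_add] at this
  have gap1 : r ≤ q + 1 := by
    by_contra hh
    exact weak_alt v hv (q - 1) q (q + 1) r (by omega) (by omega) (by omega) (by omega)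
      (p3 _ (by omega) (by omega)).le (p4 _ (by omega) (by omega)) (n4' _ (by omega) (by omega))
      (n3 _ (by omega) (by omega)).le
  have gap2 : p + n ≤ s + 1 := by
    by_contra hh
    refine weak_alt v hv s (s + 1) (p + n) (s - 1 + n) (by omega) (by omega) (by omega) (by omega)
      (n4 _ (by omega) (by omega)) (p4 _ (by omega) (by omega)) ?_ ?_
    · rw [lft_add]; exact (p3 _ (by omega) (by omega)).le
    · rw [lft_add]; exact (n3 _ (by omega) (by omega)).le
  have H := PP_main hN (lft_add w) hW (s - 1) (p + n - 1) (q - 1) (r - 1) (by omega) (by omega)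
      (by omega) (by omega)
  convert H using 1
  funext t
  rw [hy, show t + 1 - r = t - (r - 1) by ring, show t + 1 - s = t - (s - 1) by ring,
    show t + 1 - q = t - (q - 1) by ring, ← lft_add w (t - (p + n - 1)),
    show t - (p + n - 1) + n = t + 1 - p by ring]
  ring
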